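/- With U_n and U_n^{(rc)} as above, if s > t > 0, then for all n ≥ 4, det(U_n^{(rc)}) > det(U_n). Consequently, for s > t the matrix U_n does not achieve the maximum absolute determinant among n×n upper Hessenberg matrices with subdiagonal s and upper-triangular entries in [0,t]. -/

import Mathlib

/-- The upper Hessenberg matrix `U_n(s,t)`. -/
def hessU (s t : ℝ) (n : ℕ) : Matrix (Fin n) (Fin n) ℝ :=
  fun i j =>
    if (i : ℕ) ≤ (j : ℕ) then (if ((j : ℕ) - (i : ℕ)) % 2 = 0 then t else 0)
    else if (i : ℕ) = (j : ℕ) + 1 then s else 0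

/-- `det(U_n)` with the convention `det(U_0) := 0`. -/
noncomputable def detU (s t : ℝ) (n : ℕ) : ℝ :=
  if n = 0 then 0 else (hessU s t n).det

/-- Permutation matrix swapping the first two rows of the identity. -/
def permR (n : ℕ) : Matrix (Fin n) (Fin n) ℝ :=
  fun i j =>
    if ((i : ℕ) = 0 ∧ (j : ℕ) = 1) ∨ ((i : ℕ) = 1 ∧ (j : ℕ) = 0) then 1
    else if (i : ℕ) = (j : ℕ) ∧ 2 ≤ (i : ℕ) then 1 else 0

/-- Permutation matrix swapping the last two columns of the identity. -/
def permC (n : ℕ) : Matrix (Fin n) (Fin n) ℝ :=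
  fun i j =>
    if ((i : ℕ) = n - 2 ∧ (j : ℕ) = n - 1) ∨ ((i : ℕ) = n - 1 ∧ (j : ℕ) = n - 2) then 1
    else if (i : ℕ) = (j : ℕ) ∧ (i : ℕ) < n - 2 then 1 else 0

/-- The matrix `B` equal to `U_n` except that its `(1,1)` entry is `s`, its
`(2,1)` entry is `t`, its `(n,n-1)` entry is `t` and its `(n,n)` entry is `s`
(1-indexed); its `(n-1,n)` entry is `0` and `(n-1,n-1)` entry is `t` as in `U_n`. -/
def matB (s t : ℝ) (n : ℕ) : Matrix (Fin n) (Fin n) ℝ :=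
  fun i j =>
    if (i : ℕ) = 0 ∧ (j : ℕ) = 0 then s
    else if (i : ℕ) = 1 ∧ (j : ℕ) = 0 then t
    else if (i : ℕ) = n - 1 ∧ (j : ℕ) = n - 2 then t
    else if (i : ℕ) = n - 1 ∧ (j : ℕ) = n - 1 then s
    else hessU s t n i j

/-- `U_n^{(rc)} = P_n^{(r)} ⬝ B ⬝ P_n^{(c)}`. -/
noncomputable def hessUrc (s t : ℝ) (n : ℕ) : Matrix (Fin n) (Fin n) ℝ :=
  permR n * matB s t n * permC n

/-- `A` is an `n×n` upper Hessenberg matrix with subdiagonal entries `s`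
and upper-triangular entries in `[0,t]`. -/
def IsUpperHessenbergIcc (s t : ℝ) {n : ℕ} (A : Matrix (Fin n) (Fin n) ℝ) : Prop :=
  (∀ i j : Fin n, (i : ℕ) = (j : ℕ) + 1 → A i j = s) ∧
  (∀ i j : Fin n, (j : ℕ) + 1 < (i : ℕ) → A i j = 0) ∧
  (∀ i j : Fin n, (i : ℕ) ≤ (j : ℕ) → A i j ∈ Set.Icc (0 : ℝ) t)

lemma aux_expand {n : ℕ} (A : Matrix (Fin (n+2)) (Fin (n+2)) ℝ)
    (h : ∀ i : Fin (n+2), 2 ≤ (i : ℕ) → A i 0 = 0) :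
    A.det = A 0 0 * (A.submatrix Fin.succ Fin.succ).det
      - A 1 0 * (A.submatrix (Fin.succAbove 1) Fin.succ).det := by
  rw [Matrix.det_succ_column_zero, Fin.sum_univ_succ, Fin.sum_univ_succ, Finset.sum_eq_zero]
  · simp [Fin.succAbove_zero]
    ring
  · intro i _
    rw [h _ (by simp)]
    simp

lemma aux_val {n : ℕ} (i : Fin (n+1)) :
    ((Fin.succAbove (1 : Fin (n+2)) i : Fin (n+2)) : ℕ) = if (i : ℕ) = 0 then 0 else (i : ℕ) + 1 := by
  refine Fin.cases ?_ (fun k => ?_) i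
  · simp
  · rw [← Fin.succ_zero_eq_one, Fin.succ_succAbove_succ]
    simp

lemma aux_expand3 {n : ℕ} (A : Matrix (Fin (n+2)) (Fin (n+2)) ℝ)
    (G H : Matrix (Fin (n+1)) (Fin (n+1)) ℝ) (a b : ℝ)
    (ha : A ⟨0, by omega⟩ ⟨0, by omega⟩ = a) (hb : A ⟨1, by omega⟩ ⟨0, by omega⟩ = b)
    (h : ∀ (i : ℕ) (hi : i + 2 < n + 2), A ⟨i+2, hi⟩ ⟨0, by omega⟩ = 0)
    (hG : ∀ (i j : ℕ) (hi : i < n+1) (hj : j < n+1),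
      A ⟨i+1, by omega⟩ ⟨j+1, by omega⟩ = G ⟨i, hi⟩ ⟨j, hj⟩)
    (hH0 : ∀ (j : ℕ) (hj : j < n+1), A ⟨0, by omega⟩ ⟨j+1, by omega⟩ = H ⟨0, by omega⟩ ⟨j, hj⟩)
    (hH : ∀ (i j : ℕ) (hi : i + 1 < n+1) (hj : j < n+1),
      A ⟨i+2, by omega⟩ ⟨j+1, by omega⟩ = H ⟨i+1, hi⟩ ⟨j, hj⟩) :
    A.det = a * G.det - b * H.det := by
  rw [aux_expand]
  · have e1 : A.submatrix Fin.succ Fin.succ = G := by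
      ext i j
      exact hG i j i.2 j.2
    have e2 : A.submatrix (Fin.succAbove 1) Fin.succ = H := by
      ext i j
      rcases i with ⟨i, hi⟩
      rcases i with _ | i
      · have : (Fin.succAbove (1 : Fin (n+2)) ⟨0, hi⟩) = ⟨0, by omega⟩ := by
          apply Fin.ext; rw [aux_val]; simp
        rw [Matrix.submatrix_apply, this]
        exact hH0 j j.2
      · have : (Fin.succAbove (1 : Fin (n+2)) ⟨i+1, hi⟩) = ⟨i+2, by omega⟩ := by
          apply Fin.ext; rw [aux_val]; simp
        rw [Matrix.submatrix_apply, this]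
        exact hH i j hi j.2
    rw [e1, e2, ← ha, ← hb]
    rfl
  · rintro ⟨i, hi⟩ h2
    obtain ⟨k, rfl⟩ : ∃ k, i = k + 2 := ⟨i - 2, by simp at h2; omega⟩
    exact h k hi

/-- `U_n` with the first row replaced by `0,t,0,t,…`. -/
def auxQ (s t : ℝ) (n : ℕ) : Matrix (Fin n) (Fin n) ℝ := fun i j =>
  if (i : ℕ) = 0 then (if (j : ℕ) % 2 = 1 then t else 0) else hessU s t n i j

/-- `U_n` with modified last row. -/
def auxW (s t : ℝ) (n : ℕ) : Matrix (Fin n) (Fin n) ℝ := fun i j =>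
  if (i : ℕ) = n - 1 ∧ (j : ℕ) = n - 2 then t
  else if (i : ℕ) = n - 1 ∧ (j : ℕ) = n - 1 then s else hessU s t n i j

/-- `auxW` with the first row replaced by `0,t,0,t,…`. -/
def auxZ (s t : ℝ) (n : ℕ) : Matrix (Fin n) (Fin n) ℝ := fun i j =>
  if (i : ℕ) = 0 then (if (j : ℕ) % 2 = 1 then t else 0) else auxW s t n i j

lemma recU (s t : ℝ) (n : ℕ) : (hessU s t (n+2)).det
    = t * (hessU s t (n+1)).det - s * (auxQ s t (n+1)).det := by
  apply aux_expand3 (n := n)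
  all_goals
    intros
    simp only [auxQ, auxW, auxZ, matB, hessU, if_true, if_false]
    split_ifs <;> first | rfl | omega | (exfalso; simp_all; done) | (exfalso; simp_all; omega)

lemma recQ (s t : ℝ) (n : ℕ) : (auxQ s t (n+2)).det
    = 0 * (hessU s t (n+1)).det - s * (hessU s t (n+1)).det := by
  apply aux_expand3 (n := n)
  all_goals
    intros
    simp only [auxQ, auxW, auxZ, matB, hessU, if_true, if_false]
    split_ifs <;> first | rfl | omega | (exfalso; simp_all; done) | (exfalso; simp_all; omega)

lemma recW (s t : ℝ) (n : ℕ) : (auxW s t (n+3)).det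
    = t * (auxW s t (n+2)).det - s * (auxZ s t (n+2)).det := by
  apply aux_expand3 (n := n+1)
  all_goals
    intros
    simp only [auxQ, auxW, auxZ, matB, hessU, if_true, if_false]
    split_ifs <;> first | rfl | omega | (exfalso; simp_all; done) | (exfalso; simp_all; omega)

lemma recZ (s t : ℝ) (n : ℕ) : (auxZ s t (n+3)).det
    = 0 * (auxW s t (n+2)).det - s * (auxW s t (n+2)).det := by
  apply aux_expand3 (n := n+1)
  all_goals
    intros
    simp only [auxQ, auxW, auxZ, matB, hessU, if_true, if_false]
    split_ifs <;> first | rfl | omega | (exfalso; simp_all; done) | (exfalso; simp_all; omega)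

set_option maxHeartbeats 4000000 in
lemma recB (s t : ℝ) (n : ℕ) : (matB s t (n+3)).det
    = s * (auxW s t (n+2)).det - t * (auxZ s t (n+2)).det := by
  apply aux_expand3 (n := n+1)
  all_goals
    intros
    simp only [auxQ, auxW, auxZ, matB, hessU, if_true, if_false]
    split_ifs <;> first | rfl | omega | (exfalso; simp_all; done) | (exfalso; simp_all; omega)

lemma U1 (s t : ℝ) : (hessU s t 1).det = t := by simp [hessU]
lemma Q1 (s t : ℝ) : (auxQ s t 1).det = 0 := by simp [auxQ]
lemma W2 (s t : ℝ) : (auxW s t 2).det = t * s := by simp [Matrix.det_fin_two, auxW, hessU]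
lemma Z2 (s t : ℝ) : (auxZ s t 2).det = - t ^ 2 := by
  simp [Matrix.det_fin_two, auxZ, auxW, hessU]; ring

lemma U_pos (s t : ℝ) (ht : 0 < t) (hs : 0 < s) (n : ℕ) :
    0 < (hessU s t (n+1)).det ∧ (auxQ s t (n+1)).det ≤ 0 := by
  induction n with
  | zero => rw [zero_add, U1, Q1]; exact ⟨ht, le_rfl⟩
  | succ n ih =>
    rw [recU, recQ]
    obtain ⟨h1, h2⟩ := ih
    constructor
    · nlinarith [mul_pos ht h1]
    · nlinarith [mul_pos hs h1]

lemma diff_eq (s t : ℝ) (n : ℕ) :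
    (matB s t (n+4)).det = (hessU s t (n+4)).det
      + t * (s^2 - t^2) * (hessU s t (n+1)).det := by
  have w3 : (auxW s t 3).det = t * (auxW s t 2).det - s * (auxZ s t 2).det := recW s t 0
  have z3 : (auxZ s t 3).det = 0 * (auxW s t 2).det - s * (auxW s t 2).det := recZ s t 0
  have u4 : (hessU s t 4).det = t * (hessU s t 3).det - s * (auxQ s t 3).det := recU s t 2
  have u3 : (hessU s t 3).det = t * (hessU s t 2).det - s * (auxQ s t 2).det := recU s t 1
  have u2 : (hessU s t 2).det = t * (hessU s t 1).det - s * (auxQ s t 1).det := recU s t 0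
  have q3 : (auxQ s t 3).det = 0 * (hessU s t 2).det - s * (hessU s t 2).det := recQ s t 1
  have q2 : (auxQ s t 2).det = 0 * (hessU s t 1).det - s * (hessU s t 1).det := recQ s t 0
  induction n using Nat.twoStepInduction with
  | zero =>
    have b : (matB s t 4).det = _ := recB s t 1
    rw [b, w3, z3, u4, u3, q3, u2, q2, U1, Q1, W2, Z2]
    ring
  | one =>
    have b : (matB s t 5).det = _ := recB s t 2
    have w4 : (auxW s t 4).det = _ := recW s t 1
    have z4 : (auxZ s t 4).det = _ := recZ s t 1
    have u5 : (hessU s t 5).det = _ := recU s t 3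
    have q4 : (auxQ s t 4).det = _ := recQ s t 2
    simp only [Nat.reduceAdd] at *
    rw [b, w4, z4, w3, z3, u5, q4, u4, u3, q3, u2, q2, U1, Q1, W2, Z2]
    ring
  | more n h1 h2 =>
    have e1 := recU s t (n+4)
    have e2 := recQ s t (n+3)
    have e3 := recU s t (n+1)
    have e4 := recQ s t n
    have b0 := recB s t (n+1)
    have b1 := recB s t (n+2)
    have b2 := recB s t (n+3)
    have w1 := recW s t (n+1)
    have w2 := recW s t (n+2)
    have z1 := recZ s t (n+1)
    have z2 := recZ s t (n+2)
    have hB : (matB s t (n+6)).det = t * (matB s t (n+5)).det + s^2 * (matB s t (n+4)).det := by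
      rw [b0, b1, b2, w2, z2, w1, z1]; ring
    rw [hB, h1, h2, e1, e2, e3, e4]; ring

lemma rc_eq (s t : ℝ) (n : ℕ) : hessUrc s t (n+4) =
    ((matB s t (n+4)).submatrix (Equiv.swap ⟨0, by omega⟩ ⟨1, by omega⟩) id).submatrix id
      (Equiv.swap ⟨n+2, by omega⟩ ⟨n+3, by omega⟩) := by
  have hR : permR (n+4) = (1 : Matrix (Fin (n+4)) (Fin (n+4)) ℝ).submatrix
      (Equiv.swap ⟨0, by omega⟩ ⟨1, by omega⟩) id := by
    ext ⟨i, hi⟩ ⟨j, hj⟩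
    simp only [permR, Matrix.submatrix_apply, Matrix.one_apply, Equiv.swap_apply_def, id,
      Fin.mk.injEq]
    obtain rfl | rfl | ⟨h, h'⟩ : i = 0 ∨ i = 1 ∨ (i ≠ 0 ∧ i ≠ 1) := by omega
    · simp [eq_comm]
    · simp [eq_comm]
    · simp only [h, h', if_false, false_and, or_self, Fin.mk.injEq]
      split_ifs <;> first | rfl | omega
  have hC : permC (n+4) = (1 : Matrix (Fin (n+4)) (Fin (n+4)) ℝ).submatrix id
      (Equiv.swap ⟨n+2, by omega⟩ ⟨n+3, by omega⟩) := by
    ext ⟨i, hi⟩ ⟨j, hj⟩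
    simp only [permC, Matrix.submatrix_apply, Matrix.one_apply, Equiv.swap_apply_def, id,
      Fin.mk.injEq]
    obtain rfl | rfl | ⟨h, h'⟩ : j = n+2 ∨ j = n+3 ∨ (j ≠ n+2 ∧ j ≠ n+3) := by omega
    · simp only [if_true, Fin.mk.injEq]
      split_ifs <;> first | rfl | omega
    · have : n + 3 ≠ n + 2 := by omega
      simp only [this, if_true, if_false, Fin.mk.injEq]
      split_ifs <;> first | rfl | omega
    · simp only [h, h', if_false, Fin.mk.injEq]
      split_ifs <;> first | rfl | omega
  rw [hessUrc, hR, hC]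
  ext i j
  simp [Matrix.mul_apply, Matrix.one_apply]

lemma rc_det (s t : ℝ) (n : ℕ) : (hessUrc s t (n+4)).det = (matB s t (n+4)).det := by
  rw [rc_eq, Matrix.det_permute', Matrix.det_permute, Equiv.Perm.sign_swap, Equiv.Perm.sign_swap]
  · simp
  · simp
  · simp

/-- Explicit row permutation on indices. -/
lemma rc_entry (s t : ℝ) (n i j i' j' : ℕ) (hi : i < n+4) (hj : j < n+4)
    (hi' : i' < n+4) (hj' : j' < n+4)
    (h1 : (i = 0 ∧ i' = 1) ∨ (i = 1 ∧ i' = 0) ∨ (2 ≤ i ∧ i' = i))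
    (h2 : (j = n+2 ∧ j' = n+3) ∨ (j = n+3 ∧ j' = n+2) ∨ (j < n+2 ∧ j' = j)) :
    hessUrc s t (n+4) ⟨i, hi⟩ ⟨j, hj⟩ = matB s t (n+4) ⟨i', hi'⟩ ⟨j', hj'⟩ := by
  rw [rc_eq, Matrix.submatrix_apply, Matrix.submatrix_apply]
  congr 1
  · simp only [Equiv.swap_apply_def, id, Fin.mk.injEq]
    split_ifs <;> simp only [Fin.mk.injEq] <;> omega
  · simp only [Equiv.swap_apply_def, id, Fin.mk.injEq]
    split_ifs <;> simp only [Fin.mk.injEq] <;> omega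

set_option maxHeartbeats 4000000 in
lemma rc_hess (s t : ℝ) (ht : 0 < t) (n : ℕ) : IsUpperHessenbergIcc s t (hessUrc s t (n+4)) := by
  have hx : ∀ i, i < n+4 → ∃ i', i' < n+4 ∧
      ((i = 0 ∧ i' = 1) ∨ (i = 1 ∧ i' = 0) ∨ (2 ≤ i ∧ i' = i)) := by
    intro i hi
    obtain h | h | h : i = 0 ∨ i = 1 ∨ 2 ≤ i := by omega
    · exact ⟨1, by omega, by omega⟩
    · exact ⟨0, by omega, by omega⟩
    · exact ⟨i, by omega, by omega⟩
  have hy : ∀ j, j < n+4 → ∃ j', j' < n+4 ∧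
      ((j = n+2 ∧ j' = n+3) ∨ (j = n+3 ∧ j' = n+2) ∨ (j < n+2 ∧ j' = j)) := by
    intro i hi
    obtain h | h | h : i = n+2 ∨ i = n+3 ∨ i < n+2 := by omega
    · exact ⟨n+3, by omega, by omega⟩
    · exact ⟨n+2, by omega, by omega⟩
    · exact ⟨i, by omega, by omega⟩
  refine ⟨?_, ?_, ?_⟩
  all_goals
    rintro ⟨i, hi⟩ ⟨j, hj⟩ h
    obtain ⟨i', hi', h1⟩ := hx i hi
    obtain ⟨j', hj', h2⟩ := hy j hj
    rw [rc_entry s t n i j i' j' hi hj hi' hj' h1 h2]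
    dsimp only at h
    unfold matB hessU
    dsimp only
    split_ifs <;> first | rfl | exact ⟨ht.le, le_rfl⟩ | exact ⟨le_rfl, ht.le⟩ | omega

theorem hessU_not_maximizing (s t : ℝ) (ht : 0 < t) (hst : t < s) :
    ∀ n : ℕ, 4 ≤ n →
      (hessUrc s t n).det > (hessU s t n).det ∧
      ¬ IsGreatest {x : ℝ | ∃ A : Matrix (Fin n) (Fin n) ℝ,
          IsUpperHessenbergIcc s t A ∧ x = |A.det|} |(hessU s t n).det| := by
  intro n hn
  obtain ⟨m, rfl⟩ : ∃ m, n = m + 4 := ⟨n - 4, by omega⟩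
  have hs : 0 < s := ht.trans hst
  have h1 : (hessUrc s t (m+4)).det > (hessU s t (m+4)).det := by
    rw [rc_det, diff_eq]
    have := (U_pos s t ht hs m).1
    have h2 : 0 < s^2 - t^2 := by nlinarith
    have := mul_pos (mul_pos ht h2) this
    linarith
  refine ⟨h1, fun hg => ?_⟩
  have h2 := hg.2 ⟨_, rc_hess s t ht m, rfl⟩
  have h3 := (U_pos s t ht hs (m+3)).1
  rw [abs_of_pos h3, abs_of_pos (h3.trans h1)] at h2
  linarith
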